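/- In 𝓛(ε) the identity (T_l(ω) − d^l)·d^l − b^l·c^l = 1 holds. -/

import Mathlib

set_option synthInstance.maxHeartbeats 1000000

noncomputable section

variable (R : Type*) [CommRing R]

/-- Generators. -/
def gA : FreeAlgebra R (Fin 4) := FreeAlgebra.ι R 0
def gB : FreeAlgebra R (Fin 4) := FreeAlgebra.ι R 1
def gC : FreeAlgebra R (Fin 4) := FreeAlgebra.ι R 2
def gD : FreeAlgebra R (Fin 4) := FreeAlgebra.ι R 3

/-- Defining relations of 𝓛₀,₁, with `s` standing for `q²` and `t` for `q⁻²`. -/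
inductive LRel (s t : R) : FreeAlgebra R (Fin 4) → FreeAlgebra R (Fin 4) → Prop
  | rel1 : LRel s t (gA R * gD R) (gD R * gA R)
  | rel2 : LRel s t (gA R * gB R - gB R * gA R)
      (-(algebraMap R (FreeAlgebra R (Fin 4)) (1 - t) * (gB R * gD R)))
  | rel3 : LRel s t (gD R * gB R) (algebraMap R (FreeAlgebra R (Fin 4)) s * (gB R * gD R))
  | rel4 : LRel s t (gC R * gB R - gB R * gC R)
      (algebraMap R (FreeAlgebra R (Fin 4)) (1 - t) * (gD R * gA R - gD R * gD R))
  | rel5 : LRel s t (gC R * gD R) (algebraMap R (FreeAlgebra R (Fin 4)) s * (gD R * gC R))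
  | rel6 : LRel s t (gA R * gC R - gC R * gA R)
      (algebraMap R (FreeAlgebra R (Fin 4)) (1 - t) * (gD R * gC R))
  | rel7 : LRel s t (gA R * gD R - algebraMap R (FreeAlgebra R (Fin 4)) s * (gB R * gC R)) 1

/-- The quantum loop algebra with parameters `s = q²`, `t = q⁻²`. -/
def QLoop (s t : R) : Type _ := RingQuot (LRel R s t)

instance (s t : R) : Ring (QLoop R s t) := RingQuot.instRing _
instance (s t : R) : Algebra R (QLoop R s t) := RingQuot.instAlgebra _

/-- The generators a, b, c, d of the quantum loop algebra. -/
def qa (s t : R) : QLoop R s t := RingQuot.mkAlgHom R (LRel R s t) (gA R)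
def qb (s t : R) : QLoop R s t := RingQuot.mkAlgHom R (LRel R s t) (gB R)
def qc (s t : R) : QLoop R s t := RingQuot.mkAlgHom R (LRel R s t) (gC R)
def qd (s t : R) : QLoop R s t := RingQuot.mkAlgHom R (LRel R s t) (gD R)

/-- The specialization 𝓛(q₀) at q = q₀ ∈ ℂ. -/
def Lspec (q₀ : ℂ) : Type := QLoop ℂ (q₀ ^ 2) ((q₀ ^ 2)⁻¹)

instance (q₀ : ℂ) : Ring (Lspec q₀) := inferInstanceAs (Ring (QLoop ℂ _ _))
instance (q₀ : ℂ) : Algebra ℂ (Lspec q₀) := inferInstanceAs (Algebra ℂ (QLoop ℂ _ _))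


/-- The generators a, b, c, d of 𝓛(q₀). -/
def la (q₀ : ℂ) : Lspec q₀ := qa ℂ (q₀ ^ 2) ((q₀ ^ 2)⁻¹)
def lb (q₀ : ℂ) : Lspec q₀ := qb ℂ (q₀ ^ 2) ((q₀ ^ 2)⁻¹)
def lc (q₀ : ℂ) : Lspec q₀ := qc ℂ (q₀ ^ 2) ((q₀ ^ 2)⁻¹)
def ld (q₀ : ℂ) : Lspec q₀ := qd ℂ (q₀ ^ 2) ((q₀ ^ 2)⁻¹)

/-- The central element ω := q₀·a + q₀⁻¹·d of 𝓛(q₀). -/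
def omegaL (q₀ : ℂ) : Lspec q₀ :=
  algebraMap ℂ (Lspec q₀) q₀ * la q₀ + algebraMap ℂ (Lspec q₀) q₀⁻¹ * ld q₀

open MvPolynomial in
/-- The factor `-t (t^{2k} y² - t^k w y + 1)`, with `w = X 0` and `y = X 1`. -/
def quadFactor (t : ℂ) (k : ℕ) : MvPolynomial (Fin 2) ℂ :=
  C (-t) * ((C (t ^ k) * X 1) ^ 2 - X 0 * (C (t ^ k) * X 1) + 1)

/-- The linear factors `t^k y - u` multiply to `y^l - u^l`. -/
theorem prod_pow_mul_sub (t : ℂ) (l : ℕ) (hodd : Odd l) (ht : IsPrimitiveRoot t l) (y u : ℂ) :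
    ∏ k ∈ Finset.range l, (t ^ k * y - u) = y ^ l - u ^ l := by
  have h := ht.pow_sub_pow_eq_prod_sub_mul u y hodd.pos
  have hmap : ∏ k ∈ Finset.range l, (u - t ^ k * y)
      = ∏ ζ ∈ Polynomial.nthRootsFinset l (1 : ℂ), (u - ζ * y) := by
    refine Finset.prod_bij (fun k _ => t ^ k) ?_ ?_ ?_ (fun _ _ => rfl)
    · intro k _
      rw [Polynomial.mem_nthRootsFinset hodd.pos, ← pow_mul, mul_comm, pow_mul, ht.pow_eq_one,
        one_pow]
    · intro i hi j hj hij
      exact ht.pow_inj (Finset.mem_range.1 hi) (Finset.mem_range.1 hj) hij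
    · intro ζ hζ
      rw [Polynomial.mem_nthRootsFinset hodd.pos] at hζ
      have : NeZero l := ⟨hodd.pos.ne'⟩
      obtain ⟨i, hi, rfl⟩ := ht.eq_pow_of_pow_eq_one hζ
      exact ⟨i, Finset.mem_range.2 hi, rfl⟩
  rw [← hmap] at h
  have hneg : ∏ k ∈ Finset.range l, (t ^ k * y - u)
      = ∏ k ∈ Finset.range l, (-1 * (u - t ^ k * y)) :=
    Finset.prod_congr rfl fun k _ => by ring
  rw [hneg, Finset.prod_mul_distrib, Finset.prod_const, Finset.card_range, hodd.neg_one_pow, ← h]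
  ring

theorem exists_add_inv_eq (w : ℂ) : ∃ u : ℂ, u ≠ 0 ∧ u + u⁻¹ = w := by
  obtain ⟨r, hr⟩ := IsAlgClosed.exists_pow_nat_eq (w ^ 2 - 4) (n := 2) (by norm_num)
  have hmul : (w + r) / 2 * ((w - r) / 2) = 1 := by linear_combination (-1 / 4) * hr
  refine ⟨(w + r) / 2, left_ne_zero_of_mul_eq_one hmul, ?_⟩
  rw [inv_eq_of_mul_eq_one_right hmul]
  ring

open MvPolynomial in
theorem prod_quadFactor (t : ℂ) (l : ℕ) (hodd : Odd l) (ht : IsPrimitiveRoot t l)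
    (P : Polynomial ℤ)
    (hP : ∀ u : ℂ, u ≠ 0 → Polynomial.aeval (u + u⁻¹) P = u ^ l + u⁻¹ ^ l) :
    ∏ k ∈ Finset.range l, quadFactor t k
      = (Polynomial.aeval (X 0 : MvPolynomial (Fin 2) ℂ) P - X 1 ^ l) * X 1 ^ l - 1 := by
  refine MvPolynomial.funext fun v => ?_
  obtain ⟨u, hu, huv⟩ := exists_add_inv_eq (v 0)
  have hev : eval v (Polynomial.aeval (X 0 : MvPolynomial (Fin 2) ℂ) P) = u ^ l + u⁻¹ ^ l := by
    have h := Polynomial.aeval_algHom_apply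
      ((aeval v : MvPolynomial (Fin 2) ℂ →ₐ[ℂ] ℂ).restrictScalars ℤ) (X 0) P
    simp only [AlgHom.restrictScalars_apply, aeval_X, aeval_eq_eval] at h
    rw [← hP u hu, huv, h]
  have hfac : ∀ k, eval v (quadFactor t k) = -t * ((t ^ k * v 1 - u) * (t ^ k * v 1 - u⁻¹)) := by
    intro k
    simp only [quadFactor, map_mul, map_add, map_sub, map_pow, map_one, eval_C, eval_X, ← huv]
    linear_combination t * (mul_inv_cancel₀ hu)
  have hul : u ^ l * u⁻¹ ^ l = 1 := by rw [← mul_pow, mul_inv_cancel₀ hu, one_pow]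
  rw [map_prod]
  simp only [hfac, Finset.prod_mul_distrib, prod_pow_mul_sub t l hodd ht, Finset.prod_const,
    Finset.card_range, hodd.neg_pow, ht.pow_eq_one, map_sub, map_mul, map_pow, map_one, hev, eval_X]
  linear_combination -hul

open scoped IsMulCommutative in
/-- Evaluation of bivariate polynomials at two commuting elements. -/
theorem exists_algHom_of_commute {A : Type*} [Ring A] [Algebra ℂ A] {w y : A}
    (h : Commute w y) :
    ∃ φ : MvPolynomial (Fin 2) ℂ →ₐ[ℂ] A, φ (MvPolynomial.X 0) = w ∧ φ (MvPolynomial.X 1) = y := by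
  have hcomm : ∀ x ∈ ({w, y} : Set A), ∀ z ∈ ({w, y} : Set A), x * z = z * x := by
    rintro x (rfl | rfl) z (rfl | rfl)
    exacts [rfl, h.eq, h.eq.symm, rfl]
  have := Algebra.isMulCommutative_adjoin ℂ hcomm
  let w' : Algebra.adjoin ℂ ({w, y} : Set A) := ⟨w, Algebra.subset_adjoin (by simp)⟩
  let y' : Algebra.adjoin ℂ ({w, y} : Set A) := ⟨y, Algebra.subset_adjoin (by simp)⟩
  refine ⟨(Algebra.adjoin ℂ ({w, y} : Set A)).val.comp (MvPolynomial.aeval ![w', y']), ?_, ?_⟩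
  · simp [w']
  · simp [y']

/-- If `b` and `c` shift the variable `y`, and `b c` is quadratic in `y`, then `b^n c^n` is a
product of shifted quadratic factors. -/
theorem pow_mul_pow_eq_prod_quadFactor {A : Type*} [Ring A] [Algebra ℂ A] (t : ℂ)
    {b c w y : A} (φ : MvPolynomial (Fin 2) ℂ →ₐ[ℂ] A) (hw : φ (MvPolynomial.X 0) = w)
    (hy : φ (MvPolynomial.X 1) = y) (hbw : b * w = w * b) (hby : b * y = t • (y * b))
    (hbc : b * c = φ (quadFactor t 0)) (n : ℕ) :
    b ^ n * c ^ n = φ (∏ k ∈ Finset.range n, quadFactor t k) := by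
  have hφ : ∀ k, φ (quadFactor t k) = -t • ((t ^ k • y) ^ 2 - w * (t ^ k • y) + 1) := by
    intro k
    simp only [quadFactor, map_mul, map_add, map_sub, map_pow, map_one, hw, hy,
      ← MvPolynomial.algebraMap_eq, AlgHom.commutes, Algebra.smul_def, map_neg]
  have hshift : ∀ k, b * φ (quadFactor t k) = φ (quadFactor t (k + 1)) * b := by
    intro k
    have h1 : b * (t ^ k • y) = (t ^ (k + 1) • y) * b := by
      rw [mul_smul_comm, hby, smul_smul, smul_mul_assoc, pow_succ]
    rw [hφ, hφ, mul_smul_comm, smul_mul_assoc]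
    congr 1
    rw [mul_add, mul_sub, add_mul, sub_mul, mul_one, one_mul, sq, sq, ← mul_assoc, h1, mul_assoc,
      h1, ← mul_assoc, ← mul_assoc b w, hbw, mul_assoc w b, h1, ← mul_assoc]
  have hpow : ∀ k, b ^ k * φ (quadFactor t 0) = φ (quadFactor t k) * b ^ k := by
    intro k
    induction k with
    | zero => simp
    | succ k ih => rw [pow_succ', mul_assoc, ih, ← mul_assoc, hshift, mul_assoc]
  induction n with
  | zero => simp
  | succ n ih =>
    rw [pow_succ, pow_succ' c, mul_assoc, ← mul_assoc b, hbc, ← mul_assoc, hpow, mul_assoc, ih,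
      Finset.prod_range_succ, mul_comm, map_mul]

/-- The Chebyshev identity in any algebra whose elements satisfy the relations used. -/
theorem chebyshev_sub_pow_mul_pow_sub {A : Type*} [Ring A] [Algebra ℂ A] (l : ℕ) (hodd : Odd l)
    (q : ℂ) (hq : IsPrimitiveRoot q l) (P : Polynomial ℤ)
    (hP : ∀ u : ℂ, u ≠ 0 → Polynomial.aeval (u + u⁻¹) P = u ^ l + u⁻¹ ^ l) {a b c d : A}
    (had : a * d = d * a) (hab : a * b - b * a = -((1 - (q ^ 2)⁻¹) • (b * d)))
    (hdb : d * b = q ^ 2 • (b * d)) (hdet : a * d - q ^ 2 • (b * c) = 1) :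
    (Polynomial.aeval (q • a + q⁻¹ • d) P - d ^ l) * d ^ l - b ^ l * c ^ l = 1 := by
  have hq0 : q ≠ 0 := hq.ne_zero hodd.pos.ne'
  have ht : IsPrimitiveRoot (q ^ 2)⁻¹ l :=
    (hq.pow_of_coprime 2 (Nat.coprime_two_left.2 hodd)).inv
  have hwy : Commute (q • a + q⁻¹ • d) (q⁻¹ • d) := by
    have h : Commute a d := had
    exact ((h.smul_left q).add_left ((Commute.refl d).smul_left q⁻¹)).smul_right q⁻¹
  obtain ⟨φ, hφw, hφy⟩ := exists_algHom_of_commute hwy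
  have hbd : b * d = (q ^ 2)⁻¹ • (d * b) := by
    rw [hdb, smul_smul, inv_mul_cancel₀ (pow_ne_zero 2 hq0), one_smul]
  have hby : b * (q⁻¹ • d) = (q ^ 2)⁻¹ • ((q⁻¹ • d) * b) := by
    rw [mul_smul_comm, hbd, smul_mul_assoc, smul_comm]
  have hbw : b * (q • a + q⁻¹ • d) = (q • a + q⁻¹ • d) * b := by
    have hab' : a * b = b * a - (1 - (q ^ 2)⁻¹) • (b * d) := by
      rw [sub_eq_iff_eq_add'.1 hab, ← sub_eq_add_neg]
    rw [mul_add, add_mul, smul_mul_assoc, smul_mul_assoc, hab', hdb, mul_smul_comm, mul_smul_comm]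
    match_scalars <;> field_simp <;> ring
  have hbc : b * c = φ (quadFactor (q ^ 2)⁻¹ 0) := by
    have hbc' : b * c = (q ^ 2)⁻¹ • (a * d - 1) := by
      rw [← hdet, sub_sub_cancel, smul_smul, inv_mul_cancel₀ (pow_ne_zero 2 hq0), one_smul]
    simp only [quadFactor, map_mul, map_add, map_sub, map_pow, map_one, hφw, hφy, pow_zero,
      one_mul, ← MvPolynomial.algebraMap_eq, AlgHom.commutes]
    rw [hbc', ← Algebra.smul_def, sq (q⁻¹ • d), add_mul]
    simp only [smul_mul_assoc, mul_smul_comm]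
    match_scalars <;> field_simp <;> ring
  have hyl : (q⁻¹ • d) ^ l = d ^ l := by
    rw [smul_pow, inv_pow, hq.pow_eq_one, inv_one, one_smul]
  have hφP : φ (Polynomial.aeval (MvPolynomial.X 0) P) = Polynomial.aeval (q • a + q⁻¹ • d) P := by
    rw [← hφw]
    exact (Polynomial.aeval_algHom_apply (φ.restrictScalars ℤ) (MvPolynomial.X 0) P).symm
  rw [pow_mul_pow_eq_prod_quadFactor _ φ hφw hφy hbw hby hbc, prod_quadFactor _ l hodd ht P hP,
    map_sub, map_mul, map_sub, map_pow, hφy, hyl, hφP, map_one]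
  exact sub_sub_cancel _ _

theorem qa_mul_qd {R : Type*} [CommRing R] (s t : R) :
    qa R s t * qd R s t = qd R s t * qa R s t := by
  have h := RingQuot.mkAlgHom_rel R (LRel.rel1 (s := s) (t := t))
  rwa [map_mul, map_mul] at h

theorem qa_mul_qb_sub {R : Type*} [CommRing R] (s t : R) :
    qa R s t * qb R s t - qb R s t * qa R s t = -((1 - t) • (qb R s t * qd R s t)) := by
  have h := RingQuot.mkAlgHom_rel R (LRel.rel2 (s := s) (t := t))
  rw [← Algebra.smul_def] at h
  rwa [map_sub, map_neg, map_smul, map_mul, map_mul, map_mul] at h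

theorem qd_mul_qb {R : Type*} [CommRing R] (s t : R) :
    qd R s t * qb R s t = s • (qb R s t * qd R s t) := by
  have h := RingQuot.mkAlgHom_rel R (LRel.rel3 (s := s) (t := t))
  rw [← Algebra.smul_def] at h
  rwa [map_smul, map_mul, map_mul] at h

theorem qa_mul_qd_sub {R : Type*} [CommRing R] (s t : R) :
    qa R s t * qd R s t - s • (qb R s t * qc R s t) = 1 := by
  have h := RingQuot.mkAlgHom_rel R (LRel.rel7 (s := s) (t := t))
  rw [← Algebra.smul_def] at h
  rwa [map_sub, map_smul, map_mul, map_mul, map_one] at h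

/-- Let `l ≥ 3` be odd, `ε` a primitive `l`-th root of unity, and `T_l` the
rescaled Chebyshev polynomial of the first kind (the unique integer polynomial with
`T_l(u + u⁻¹) = u^l + u⁻ˡ` for all invertible `u`).  Then in 𝓛(ε) the identity
`(T_l(ω) − d^l)·d^l − b^l·c^l = 1` holds. -/
theorem stmt_7 (l : ℕ) (hodd : Odd l) (hl : 3 ≤ l) (ε : ℂ) (hε : IsPrimitiveRoot ε l)
    (P : Polynomial ℤ)
    (hP : ∀ u : ℂ, u ≠ 0 → Polynomial.aeval (u + u⁻¹) P = u ^ l + u⁻¹ ^ l) :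
    (Polynomial.aeval (omegaL ε) P - ld ε ^ l) * ld ε ^ l - lb ε ^ l * lc ε ^ l = 1 := by
  rw [omegaL, ← Algebra.smul_def, ← Algebra.smul_def]
  exact chebyshev_sub_pow_mul_pow_sub l hodd ε hε P hP (qa_mul_qd _ _) (qa_mul_qb_sub _ _)
    (qd_mul_qb _ _) (qa_mul_qd_sub _ _)

end
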